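/- Suppose there exists a universal constant c_3 > 0 such that for every dimension d and every convex body K ⊆ ℝ^d the isotropic constant satisfies L_K ≤ c_3 (the slicing conjecture). Then there exists a universal constant c_1 > 0 such that for every dimension d and every pair of convex bodies K ⊆ M ⊆ ℝ^d one has det A(K) ≤ c_1^d · det A(M). -/

import Mathlib

open MeasureTheory

/-- A convex body in `ℝ^d`: a compact convex set with nonempty interior. -/
def IsConvexBody {d : ℕ} (K : Set (EuclideanSpace ℝ (Fin d))) : Prop :=
  IsCompact K ∧ Convex ℝ K ∧ (interior K).Nonempty

/-- The centroid `μ(K)` of `K`: the expectation of a uniformly random point of `K`. -/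
noncomputable def centroid {d : ℕ} (K : Set (EuclideanSpace ℝ (Fin d))) :
    EuclideanSpace ℝ (Fin d) :=
  ⨍ x in K, x

/-- The covariance matrix `A(K)` of a uniformly random point of `K`. -/
noncomputable def covMatrix {d : ℕ} (K : Set (EuclideanSpace ℝ (Fin d))) :
    Matrix (Fin d) (Fin d) ℝ :=
  Matrix.of fun i j => ⨍ x in K, (x i - centroid K i) * (x j - centroid K j)

/-- The isotropic constant `L_K`, defined by `L_K^{2d} = det A(K)/(vol K)²`. -/
noncomputable def isotropicConstant {d : ℕ} (K : Set (EuclideanSpace ℝ (Fin d))) : ℝ :=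
  ((covMatrix K).det / (volume K).toReal ^ 2) ^ ((1 : ℝ) / (2 * d))

open scoped Matrix ComplexOrder MatrixOrder

theorem IsConvexBody.volumeReal_pos {d : ℕ} {K : Set (EuclideanSpace ℝ (Fin d))}
    (hK : IsConvexBody K) : 0 < volume.real K :=
  ENNReal.toReal_pos (Measure.measure_pos_of_nonempty_interior _ hK.2.2).ne' hK.1.measure_lt_top.ne

/-- The integral of the square of a centred linear form is a quadratic form in the covariance
matrix. -/
theorem IsConvexBody.setIntegral_dotProduct_sq {d : ℕ} {K : Set (EuclideanSpace ℝ (Fin d))}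
    (hK : IsConvexBody K) (v : Fin d → ℝ) :
    ∫ x in K, (∑ j, v j * (x j - centroid K j)) ^ 2 =
      volume.real K * (v ⬝ᵥ covMatrix K *ᵥ v) := by
  have hint (i j : Fin d) : IntegrableOn
      (fun x : EuclideanSpace ℝ (Fin d) =>
        (v i * (x i - centroid K i)) * (v j * (x j - centroid K j))) K :=
    ContinuousOn.integrableOn_compact hK.1 (by fun_prop)
  simp_rw [sq, Finset.sum_mul_sum]
  rw [integral_finsetSum _ fun i _ => integrable_finsetSum _ fun j _ => hint i j]
  simp_rw [dotProduct, Matrix.mulVec, dotProduct, Finset.mul_sum]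
  refine Finset.sum_congr rfl fun i _ => ?_
  rw [integral_finsetSum _ fun j _ => hint i j]
  refine Finset.sum_congr rfl fun j _ => ?_
  have : ∀ x : EuclideanSpace ℝ (Fin d),
      (v i * (x i - centroid K i)) * (v j * (x j - centroid K j)) =
        (v i * v j) * ((x i - centroid K i) * (x j - centroid K j)) := fun x => by ring
  simp_rw [this, integral_const_mul, covMatrix, Matrix.of_apply, setAverage_eq, smul_eq_mul]
  field_simp [hK.volumeReal_pos.ne']

theorem IsConvexBody.posDef_covMatrix {d : ℕ} {K : Set (EuclideanSpace ℝ (Fin d))}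
    (hK : IsConvexBody K) : (covMatrix K).PosDef := by
  refine .of_dotProduct_mulVec_pos ?_ fun v hv => ?_
  · ext i j
    simp [covMatrix, mul_comm]
  rw [star_trivial, ← mul_pos_iff_of_pos_left hK.volumeReal_pos, ← hK.setIntegral_dotProduct_sq]
  set f : EuclideanSpace ℝ (Fin d) → ℝ := fun x => (∑ j, v j * (x j - centroid K j)) ^ 2 with hf
  have hcont : Continuous f := by fun_prop
  rw [setIntegral_pos_iff_support_of_nonneg_ae (.of_forall fun x => sq_nonneg _)
    (hcont.continuousOn.integrableOn_compact hK.1)]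
  obtain ⟨x, hx⟩ := hK.2.2
  have hvv : 0 < ∑ j, v j * v j := by
    simpa [dotProduct] using (Matrix.dotProduct_star_self_pos_iff (v := v)).2 hv
  have hsupp : (Function.support f ∩ interior K).Nonempty := by
    by_contra hempty
    have hzero (y) (hy : y ∈ interior K) : ∑ j, v j * (y j - centroid K j) = 0 := by
      by_contra hne
      exact hempty ⟨y, pow_ne_zero 2 hne, hy⟩
    have hline : Filter.Tendsto (fun t : ℝ => x + t • WithLp.toLp 2 v) (nhds 0) (nhds x) := by
      have : Continuous (fun t : ℝ => x + t • WithLp.toLp 2 v) := by fun_prop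
      simpa using this.tendsto 0
    obtain ⟨t, ht, ht0⟩ := (((hline.eventually (isOpen_interior.mem_nhds hx)).filter_mono
      nhdsWithin_le_nhds).and (self_mem_nhdsWithin (s := {0}ᶜ))).exists
    have h := hzero _ ht
    have h' : ∑ j, v j * ((x + t • WithLp.toLp 2 v) j - centroid K j) =
        ∑ j, v j * (x j - centroid K j) + t * ∑ j, v j * v j := by
      rw [Finset.mul_sum, ← Finset.sum_add_distrib]
      refine Finset.sum_congr rfl fun j _ => ?_
      simp
      ring
    rw [h', hzero x hx, zero_add] at h
    exact (mul_ne_zero ht0 hvv.ne') h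
  exact (((hcont.isOpen_support.inter isOpen_interior).measure_pos _ hsupp)).trans_le
    (measure_mono (Set.inter_subset_inter_right _ interior_subset))

theorem integral_exp_neg_half_norm_sq_toLpLin {d : ℕ} (T : Matrix (Fin d) (Fin d) ℝ)
    (hT : T.det ≠ 0) (c : EuclideanSpace ℝ (Fin d)) :
    Integrable (fun x => Real.exp (-(1 / 2) * ‖Matrix.toLpLin 2 2 T (x - c)‖ ^ 2)) ∧
    ∫ x, Real.exp (-(1 / 2) * ‖Matrix.toLpLin 2 2 T (x - c)‖ ^ 2) =
      |T.det⁻¹| * (2 * Real.pi) ^ ((d : ℝ) / 2) := by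
  set L := Matrix.toLpLin 2 2 T
  set g : EuclideanSpace ℝ (Fin d) → ℝ := fun y => Real.exp (-(1 / 2) * ‖y‖ ^ 2) with hg
  have hgauss : ∫ y, g y = (2 * Real.pi) ^ ((d : ℝ) / 2) := by
    rw [hg, GaussianFourier.integral_rexp_neg_mul_sq_norm (by norm_num)]
    simp [mul_comm]
  have hgint : Integrable g := by
    refine .of_integral_ne_zero ?_
    rw [hgauss]
    positivity
  have hdet : LinearMap.det L ≠ 0 := by rwa [LinearMap.det_toLpLin]
  have hmap := Measure.map_linearMap_addHaar_eq_smul_addHaar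
    (volume : Measure (EuclideanSpace ℝ (Fin d))) hdet
  have hL : Measurable L := L.continuous_of_finiteDimensional.measurable
  have hgm : AEStronglyMeasurable g (Measure.map L volume) :=
    (by fun_prop : Continuous g).aestronglyMeasurable
  have hint : Integrable (fun x => g (L x)) := by
    refine (integrable_map_measure hgm hL.aemeasurable).1 ?_
    rw [hmap]
    exact hgint.smul_measure ENNReal.ofReal_ne_top
  refine ⟨hint.comp_sub_right c, ?_⟩
  rw [integral_sub_right_eq_self (fun x => g (L x)) c, ← integral_map hL.aemeasurable hgm, hmap,
    integral_smul_measure, hgauss, ENNReal.toReal_ofReal (abs_nonneg _), LinearMap.det_toLpLin,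
    smul_eq_mul]

/-- Among all bodies of given volume the determinant of the covariance matrix is bounded below:
the isotropic constant is at least `(2πe)^(-1/2)`. -/
theorem IsConvexBody.volumeReal_sq_le {d : ℕ} {K : Set (EuclideanSpace ℝ (Fin d))}
    (hK : IsConvexBody K) :
    volume.real K ^ 2 ≤ (2 * Real.pi * Real.exp 1) ^ d * (covMatrix K).det := by
  obtain ⟨B, hB⟩ := CStarAlgebra.nonneg_iff_eq_star_mul_self.mp hK.posDef_covMatrix.posSemidef.nonneg
  have hB' : covMatrix K = Bᵀ * B := by
    rw [hB, Matrix.star_eq_conjTranspose, Matrix.conjTranspose_eq_transpose_of_trivial]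
  have hdet : (covMatrix K).det = B.det ^ 2 := by
    rw [hB', Matrix.det_mul, Matrix.det_transpose, sq]
  have hdetB : B.det ≠ 0 := fun h => hK.posDef_covMatrix.det_pos.ne' (by simp [hdet, h])
  set T := (B⁻¹)ᵀ with hT
  have hTdet : T.det = B.det⁻¹ := by
    rw [hT, Matrix.det_transpose, Matrix.det_nonsing_inv, Ring.inverse_eq_inv']
  have hTA : T * covMatrix K * Tᵀ = 1 := by
    have hu : IsUnit B.det := hdetB.isUnit
    rw [hB', hT, Matrix.transpose_transpose, ← Matrix.mul_assoc, ← Matrix.transpose_mul,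
      Matrix.mul_nonsing_inv _ hu, Matrix.transpose_one, Matrix.one_mul,
      Matrix.mul_nonsing_inv _ hu]
  obtain ⟨hint, heq⟩ := integral_exp_neg_half_norm_sq_toLpLin T
    (by rw [hTdet]; exact inv_ne_zero hdetB) (centroid K)
  set q : EuclideanSpace ℝ (Fin d) → ℝ := fun x => ‖Matrix.toLpLin 2 2 T (x - centroid K)‖ ^ 2
    with hq
  have hqcont : Continuous q := by
    have := (Matrix.toLpLin 2 2 T).continuous_of_finiteDimensional
    fun_prop
  have hqsum (x) : q x = ∑ i, (∑ j, T i j * (x j - centroid K j)) ^ 2 := by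
    simp [hq, EuclideanSpace.norm_sq_eq, Matrix.toLpLin_apply, Matrix.mulVec, dotProduct]
  have hqint : ∫ x in K, q x = volume.real K * d := by
    simp_rw [hqsum]
    rw [integral_finsetSum _ fun i _ => ContinuousOn.integrableOn_compact hK.1 (by fun_prop)]
    simp_rw [hK.setIntegral_dotProduct_sq, ← Finset.mul_sum]
    congr 1
    have h (i : Fin d) : T i ⬝ᵥ covMatrix K *ᵥ T i = 1 := by
      have := congrFun (congrFun hTA i) i
      rw [Matrix.mul_assoc, Matrix.one_apply_eq] at this
      simpa [Matrix.mul_apply, dotProduct, Matrix.mulVec] using this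
    simp [h]
  have hqi : IntegrableOn q K := hqcont.continuousOn.integrableOn_compact hK.1
  have hconst (r : ℝ) : IntegrableOn (fun _ : EuclideanSpace ℝ (Fin d) => r) K :=
    continuousOn_const.integrableOn_compact hK.1
  have hjensen : Real.exp (-(d / 2)) * volume.real K ≤ |B.det| * (2 * Real.pi) ^ ((d : ℝ) / 2) := by
    calc Real.exp (-(d / 2)) * volume.real K
        = ∫ x in K, Real.exp (-(d / 2)) * ((1 + d / 2) - 1 / 2 * q x) := by
          rw [integral_const_mul, integral_sub (hconst _) (hqi.const_mul _), integral_const_mul,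
            hqint]
          simp
          ring
      _ ≤ ∫ x in K, Real.exp (-(1 / 2) * q x) := by
          refine setIntegral_mono ((hconst _).sub (hqi.const_mul _) |>.const_mul _)
            hint.integrableOn fun x => ?_
          have h := Real.add_one_le_exp (d / 2 - 1 / 2 * q x)
          have hmul := mul_le_mul_of_nonneg_left h (Real.exp_pos (-(d / 2 : ℝ))).le
          rw [← Real.exp_add] at hmul
          convert hmul using 2 <;> ring
      _ ≤ ∫ x, Real.exp (-(1 / 2) * q x) :=
          setIntegral_le_integral hint (.of_forall fun x => (Real.exp_pos _).le)
      _ = |B.det| * (2 * Real.pi) ^ ((d : ℝ) / 2) := by rw [heq, hTdet, inv_inv]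
  have hsq := pow_le_pow_left₀ (by positivity) hjensen 2
  have hexp : Real.exp (-(d / 2)) ^ 2 * Real.exp 1 ^ d = 1 := by
    rw [← Real.exp_nat_mul, ← Real.exp_nat_mul, ← Real.exp_add, Real.exp_eq_one_iff]
    push_cast
    ring
  have hpi : ((2 * Real.pi) ^ ((d : ℝ) / 2)) ^ 2 = (2 * Real.pi) ^ d := by
    rw [← Real.rpow_natCast, ← Real.rpow_mul (by positivity), ← Real.rpow_natCast]
    norm_num
  rw [mul_pow, mul_pow, hpi, sq_abs, ← hdet] at hsq
  calc volume.real K ^ 2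
      = Real.exp 1 ^ d * (Real.exp (-(d / 2)) ^ 2 * volume.real K ^ 2) := by
        linear_combination (-(volume.real K ^ 2)) * hexp
    _ ≤ Real.exp 1 ^ d * ((covMatrix K).det * (2 * Real.pi) ^ d) := by gcongr
    _ = (2 * Real.pi * Real.exp 1) ^ d * (covMatrix K).det := by rw [mul_pow _ (Real.exp 1)]; ring

theorem IsConvexBody.isotropicConstant_nonneg {d : ℕ} {K : Set (EuclideanSpace ℝ (Fin d))}
    (hK : IsConvexBody K) : 0 ≤ isotropicConstant K :=
  Real.rpow_nonneg (div_nonneg hK.posDef_covMatrix.det_pos.le (sq_nonneg _)) _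

theorem IsConvexBody.det_covMatrix_eq {d : ℕ} (hd : 0 < d) {K : Set (EuclideanSpace ℝ (Fin d))}
    (hK : IsConvexBody K) :
    (covMatrix K).det = (isotropicConstant K ^ 2) ^ d * volume.real K ^ 2 := by
  have hv := hK.volumeReal_pos.ne'
  have hcast : (1 : ℝ) / (2 * d) = ((2 * d : ℕ) : ℝ)⁻¹ := by simp
  rw [← pow_mul, isotropicConstant, hcast,
    Real.rpow_inv_natCast_pow (div_nonneg hK.posDef_covMatrix.det_pos.le (sq_nonneg _)) (by lia),
    ← measureReal_def, div_mul_cancel₀ _ (pow_ne_zero 2 hv)]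

/-- The slicing conjecture (a universal bound on the isotropic constant)
implies a universal weak monotonicity of `det A(·)` under inclusion:
`det A(K) ≤ c₁^d · det A(M)` whenever `K ⊆ M`. -/
theorem slicing_implies_weak_monotonicity_det_cov
    (hslicing : ∃ c₃ : ℝ, 0 < c₃ ∧ ∀ (d : ℕ), 0 < d →
      ∀ K : Set (EuclideanSpace ℝ (Fin d)), IsConvexBody K →
        isotropicConstant K ≤ c₃) :
    ∃ c₁ : ℝ, 0 < c₁ ∧ ∀ (d : ℕ), 0 < d →
      ∀ K M : Set (EuclideanSpace ℝ (Fin d)),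
        IsConvexBody K → IsConvexBody M → K ⊆ M →
        (covMatrix K).det ≤ c₁ ^ d * (covMatrix M).det := by
  obtain ⟨c, hc, hslice⟩ := hslicing
  refine ⟨c ^ 2 * (2 * Real.pi * Real.exp 1), by positivity, fun d hd K M hK hM hKM => ?_⟩
  calc (covMatrix K).det = (isotropicConstant K ^ 2) ^ d * volume.real K ^ 2 :=
        hK.det_covMatrix_eq hd
    _ ≤ (c ^ 2) ^ d * volume.real M ^ 2 := by
        gcongr
        · exact hK.isotropicConstant_nonneg
        · exact hslice d hd K hK
        · exact hM.1.measure_lt_top.ne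
    _ ≤ (c ^ 2) ^ d * ((2 * Real.pi * Real.exp 1) ^ d * (covMatrix M).det) := by
        gcongr
        exact hM.volumeReal_sq_le
    _ = (c ^ 2 * (2 * Real.pi * Real.exp 1)) ^ d * (covMatrix M).det := by
        rw [mul_pow (c ^ 2), mul_assoc ((c ^ 2) ^ d)]
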